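/- For every s ∈ S, the set {d(F) : F is a proper filter in S with s ∈ F} equals the set {H : H is a proper filter in S with s⁻¹·s ∈ H}; in particular, every proper filter containing s⁻¹·s arises as the source d(F) of some proper filter F containing s. -/

import Mathlib

/-- An inverse semigroup with zero: every element `a` has a unique `a⁻¹` with
`a * a⁻¹ * a = a` and `a⁻¹ * a * a⁻¹ = a⁻¹`, and `0` is absorbing. -/
class InvSemigroupWithZero (S : Type*) extends Semigroup S, Zero S, Inv S where
  mul_inv_mul : ∀ a : S, a * a⁻¹ * a = a
  inv_mul_inv : ∀ a : S, a⁻¹ * a * a⁻¹ = a⁻¹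
  inv_unique : ∀ a b : S, a * b * a = a → b * a * b = b → b = a⁻¹
  zero_mul : ∀ a : S, 0 * a = 0
  mul_zero : ∀ a : S, a * 0 = 0

namespace InvSemigroupWithZero

variable {S : Type*} [InvSemigroupWithZero S]

/-- The natural partial order on `S`: `a ≤ b` iff `a = a * a⁻¹ * b`. -/
def sle (a b : S) : Prop := a = a * a⁻¹ * b

/-- `↓s`, the down-set of `s` w.r.t. the natural partial order. -/
def dwn (s : S) : Set S := {t : S | sle t s}

/-- `↑A`, the up-set generated by `A` w.r.t. the natural partial order. -/
def up (A : Set S) : Set S := {b : S | ∃ a ∈ A, sle a b}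

/-- A filter in `S`: a nonempty down-directed up-set. -/
def IsFilt (F : Set S) : Prop :=
  F.Nonempty ∧ up F = F ∧ ∀ a ∈ F, ∀ b ∈ F, ∃ c ∈ F, sle c a ∧ sle c b

/-- A proper filter: a filter not containing `0`. -/
def IsPFilt (F : Set S) : Prop := IsFilt F ∧ (0 : S) ∉ F

/-- An ultrafilter: a proper filter maximal among proper filters. -/
def IsUltra (U : Set S) : Prop :=
  IsPFilt U ∧ ∀ G : Set S, IsPFilt G → U ⊆ G → U = G

/-- The set `E` of idempotents of `S`. -/
def E (S : Type*) [InvSemigroupWithZero S] : Set S := {e : S | e * e = e}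

/-- `F⁻¹ = {a⁻¹ : a ∈ F}`. -/
def finv (F : Set S) : Set S := (fun a : S => a⁻¹) '' F

/-- `F · G = ↑{fg : f ∈ F, g ∈ G}`. -/
def fmul (F G : Set S) : Set S := up (Set.image2 (· * ·) F G)

/-- The source `d(F) := F⁻¹ · F`. -/
def src (F : Set S) : Set S := fmul (finv F) F

/-- The range `r(F) := F · F⁻¹`. -/
def rng (F : Set S) : Set S := fmul F (finv F)

/-- The natural partial order on the idempotents: `e ≤ f` iff `e = e * f`. -/
def ele (e f : S) : Prop := e = e * f

/-- The down-set of an idempotent `e` inside `E`. -/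
def edwn (e : S) : Set S := {f : S | f ∈ E S ∧ ele f e}

/-- The up-set generated by `A` inside `E`. -/
def eup (A : Set S) : Set S := {f : S | f ∈ E S ∧ ∃ a ∈ A, ele a f}

/-- An `E`-filter: a proper filter of the inverse semigroup `E` of idempotents. -/
def IsEFilt (ξ : Set S) : Prop :=
  ξ ⊆ E S ∧ ξ.Nonempty ∧ eup ξ = ξ ∧
    (∀ a ∈ ξ, ∀ b ∈ ξ, ∃ c ∈ ξ, ele c a ∧ ele c b) ∧ (0 : S) ∉ ξ

/-- An `E`-ultrafilter: an `E`-filter maximal among `E`-filters. -/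
def IsEUltra (ξ : Set S) : Prop :=
  IsEFilt ξ ∧ ∀ η : Set S, IsEFilt η → ξ ⊆ η → ξ = η

/-- `β_s(ξ) = {f ∈ E : s·e·s⁻¹ ≤ f for some e ∈ ξ}`. -/
def beta (s : S) (ξ : Set S) : Set S :=
  {f : S | f ∈ E S ∧ ∃ e ∈ ξ, sle (s * e * s⁻¹) f}

/-- The set of proper filters in `S`. -/
abbrev PFilt (S : Type*) [InvSemigroupWithZero S] := {F : Set S // IsPFilt F}

/-- The patch topology on the set of proper filters, generated by the sets
`F(s;T) = {F : s ∈ F, F ∩ T = ∅}` for `s ∈ S` and finite `T ⊆ ↓s`. -/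
instance patchTopology : TopologicalSpace (PFilt S) :=
  TopologicalSpace.generateFrom
    {O : Set (PFilt S) | ∃ (s : S) (T : Set S), T.Finite ∧ T ⊆ dwn s ∧
      O = {F : PFilt S | s ∈ F.1 ∧ F.1 ∩ T = ∅}}

/-- The set of idempotent proper filters in `S`. -/
abbrev IPFilt (S : Type*) [InvSemigroupWithZero S] :=
  {F : Set S // IsPFilt F ∧ (F ∩ E S).Nonempty}

/-- The subspace topology induced by the patch topology on proper filters. -/
instance : TopologicalSpace (IPFilt S) :=
  TopologicalSpace.induced (fun F => (⟨F.1, F.2.1⟩ : PFilt S)) inferInstance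

/-- The set of `E`-filters. -/
abbrev EFilt (S : Type*) [InvSemigroupWithZero S] := {ξ : Set S // IsEFilt ξ}

/-- The patch topology on the set of `E`-filters, generated by the sets
`P(e;X) = {ξ : e ∈ ξ, ξ ∩ X = ∅}` for `e ∈ E` and finite `X ⊆ ↓e ∩ E`. -/
instance : TopologicalSpace (EFilt S) :=
  TopologicalSpace.generateFrom
    {O : Set (EFilt S) | ∃ (e : S) (X : Set S), e ∈ E S ∧ X.Finite ∧ X ⊆ edwn e ∧
      O = {ξ : EFilt S | e ∈ ξ.1 ∧ ξ.1 ∩ X = ∅}}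

/-- The set of ultrafilters in `S`. -/
abbrev UFilt (S : Type*) [InvSemigroupWithZero S] := {U : Set S // IsUltra U}

/-- The subspace topology induced by the patch topology on proper filters. -/
instance : TopologicalSpace (UFilt S) :=
  TopologicalSpace.induced (fun U => (⟨U.1, U.2.1⟩ : PFilt S)) inferInstance

end InvSemigroupWithZero

open InvSemigroupWithZero

namespace InvSemigroupWithZero

variable {S : Type*} [InvSemigroupWithZero S]

theorem idem_mul_idem {e f : S} (he : e * e = e) (hf : f * f = f) :
    e * f * (e * f) = e * f := by
  have h1 := mul_inv_mul (e * f)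
  have h2 := inv_mul_inv (e * f)
  have hx : f * (e * f)⁻¹ * e = (e * f)⁻¹ := by
    apply inv_unique <;> grind
  generalize (e * f)⁻¹ = x at *
  have hxx : x * x = x := by grind
  have h3 : x = x⁻¹ := inv_unique x x (by grind) (by grind)
  have h4 : e * f = x⁻¹ := inv_unique x (e * f) h2 h1
  rw [h4, ← h3, hxx]

theorem idem_comm {e f : S} (he : e * e = e) (hf : f * f = f) : e * f = f * e := by
  have h1 := idem_mul_idem he hf
  have h2 := idem_mul_idem hf he
  have h3 : e * f = (e * f)⁻¹ := inv_unique _ _ (by grind) (by grind)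
  have h4 : f * e = (e * f)⁻¹ := inv_unique _ _ (by grind) (by grind)
  rw [h3, ← h4]

theorem inv_mul_idem (a : S) : a⁻¹ * a * (a⁻¹ * a) = a⁻¹ * a := by
  have := mul_inv_mul a
  grind

theorem mul_inv_idem (a : S) : a * a⁻¹ * (a * a⁻¹) = a * a⁻¹ := by
  have := mul_inv_mul a
  grind

theorem inv_of_idem {e : S} (he : e * e = e) : e⁻¹ = e :=
  (inv_unique e e (by grind) (by grind)).symm

theorem mul_inv_rev' (a b : S) : (a * b)⁻¹ = b⁻¹ * a⁻¹ := by
  have h := idem_comm (inv_mul_idem a) (mul_inv_idem b)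
  have ha := mul_inv_mul a
  have hb := mul_inv_mul b
  have ha' := inv_mul_inv a
  have hb' := inv_mul_inv b
  symm
  apply inv_unique
  · calc a * b * (b⁻¹ * a⁻¹) * (a * b) = a * (b * b⁻¹ * (a⁻¹ * a)) * b := by grind
      _ = a * (a⁻¹ * a * (b * b⁻¹)) * b := by rw [h]
      _ = (a * a⁻¹ * a) * (b * b⁻¹ * b) := by grind
      _ = a * b := by rw [ha, hb]
  · calc b⁻¹ * a⁻¹ * (a * b) * (b⁻¹ * a⁻¹) = b⁻¹ * (a⁻¹ * a * (b * b⁻¹)) * a⁻¹ := by grind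
      _ = b⁻¹ * (b * b⁻¹ * (a⁻¹ * a)) * a⁻¹ := by rw [h]
      _ = (b⁻¹ * b * b⁻¹) * (a⁻¹ * a * a⁻¹) := by grind
      _ = b⁻¹ * a⁻¹ := by rw [ha', hb']

/-- Conjugation of an idempotent is idempotent. -/
theorem conj_idem (a : S) {e : S} (he : e * e = e) :
    a * e * a⁻¹ * (a * e * a⁻¹) = a * e * a⁻¹ := by
  have h := idem_comm (inv_mul_idem a) he
  have ha := mul_inv_mul a
  calc a * e * a⁻¹ * (a * e * a⁻¹) = a * e * (a⁻¹ * a * e) * a⁻¹ := by grind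
    _ = a * (e * e) * (a⁻¹ * a * a⁻¹) := by rw [h]; grind
    _ = a * e * a⁻¹ := by rw [he, inv_mul_inv]

theorem sle_of_left {a b e : S} (he : e * e = e) (h : a = e * b) : sle a b := by
  unfold sle
  have hc := idem_comm he (mul_inv_idem b)
  have hb := mul_inv_mul b
  rw [h, mul_inv_rev', inv_of_idem he]
  calc e * b = e * e * (b * b⁻¹ * b) := by rw [he, hb]
    _ = e * (e * (b * b⁻¹)) * b := by grind
    _ = e * (b * b⁻¹ * e) * b := by rw [hc]
    _ = e * b * (b⁻¹ * e) * b := by grind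

theorem sle_of_right {a b e : S} (he : e * e = e) (h : a = b * e) : sle a b := by
  apply sle_of_left (conj_idem b he)
  have hc := idem_comm he (inv_mul_idem b)
  calc a = b * b⁻¹ * b * e := by rw [h, mul_inv_mul]
    _ = b * (b⁻¹ * b * e) := by grind
    _ = b * e * b⁻¹ * b := by rw [← hc]; grind

theorem sle.eq_mul {a b : S} (h : sle a b) : a = b * (a⁻¹ * a) := by
  unfold sle at h
  have hc := idem_comm (inv_mul_idem b) (inv_mul_idem a)
  have hb := mul_inv_mul b
  have h1 : a⁻¹ = b⁻¹ * (a * a⁻¹) := by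
    conv_lhs => rw [h, mul_inv_rev', inv_of_idem (mul_inv_idem a)]
  have hk := idem_comm (mul_inv_idem a) (mul_inv_idem b)
  calc a = a * a⁻¹ * (a * a⁻¹) * (b * b⁻¹ * b) := by rw [mul_inv_idem, hb, ← h]
    _ = a * a⁻¹ * (a * a⁻¹ * (b * b⁻¹)) * b := by grind
    _ = (a * a⁻¹ * (b * b⁻¹)) * (a * a⁻¹ * b) := by rw [hk]; grind
    _ = b * (b⁻¹ * (a * a⁻¹)) * (a * a⁻¹ * b) := by rw [hk]; grind
    _ = b * (a⁻¹ * a) := by rw [← h1, ← h]; grind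

theorem sle_refl (a : S) : sle a a := (mul_inv_mul a).symm

theorem sle.trans {a b c : S} (h : sle a b) (h' : sle b c) : sle a c := by
  unfold sle at h h'
  refine sle_of_left (idem_mul_idem (mul_inv_idem a) (mul_inv_idem b)) ?_
  calc a = a * a⁻¹ * (b * b⁻¹ * c) := by rw [← h', ← h]
    _ = _ := by grind

theorem sle.mul {a b c d : S} (h : sle a b) (h' : sle c d) : sle (a * c) (b * d) := by
  have h1 : sle (a * c) (a * d) :=
    sle_of_right (inv_mul_idem c) (by rw [mul_assoc, ← h'.eq_mul])
  have h2 : sle (a * d) (b * d) :=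
    sle_of_left (mul_inv_idem a) (by rw [← mul_assoc, ← (show a = _ from h)])
  exact h1.trans h2

theorem sle.inv {a b : S} (h : sle a b) : sle a⁻¹ b⁻¹ := by
  refine sle_of_right (mul_inv_idem a) ?_
  conv_lhs => rw [show a = _ from h, mul_inv_rev', inv_of_idem (mul_inv_idem a)]

theorem sle.idem {a e : S} (h : sle a e) (he : e * e = e) : a * a = a := by
  rw [show a = _ from h]
  exact idem_mul_idem (mul_inv_idem a) he

theorem sle.eq_mul_idem {a e : S} (h : sle a e) (he : e * e = e) : a = a * e := by
  have h' : a = a * a⁻¹ * e := h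
  calc a = a * a⁻¹ * (e * e) := by rw [he, ← h']
    _ = a * e := by rw [← mul_assoc, ← h']

theorem sle_zero {a : S} (h : sle a 0) : a = 0 := by
  rw [show a = _ from h, mul_zero]

theorem IsFilt.mem_of_sle {F : Set S} (hF : IsFilt F) {a b : S} (ha : a ∈ F) (h : sle a b) :
    b ∈ F := by
  rw [← hF.2.1]
  exact ⟨a, ha, h⟩

theorem up_up (A : Set S) : up (up A) = up A := by
  ext x
  constructor
  · rintro ⟨a, ⟨b, hb, hba⟩, hax⟩
    exact ⟨b, hb, hba.trans hax⟩
  · intro hx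
    exact ⟨x, hx, sle_refl x⟩

/-- The upward closure of a down-directed nonempty set avoiding zero is a proper filter. -/
theorem isPFilt_up {A : Set S} (hne : A.Nonempty)
    (hdir : ∀ a ∈ A, ∀ b ∈ A, ∃ c ∈ A, sle c a ∧ sle c b) (h0 : (0 : S) ∉ A) :
    IsPFilt (up A) := by
  refine ⟨⟨hne.imp fun a ha => ⟨a, ha, sle_refl a⟩, up_up A, ?_⟩, ?_⟩
  · rintro a ⟨a', ha', haa⟩ b ⟨b', hb', hbb⟩
    obtain ⟨c, hc, hca, hcb⟩ := hdir a' ha' b' hb'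
    exact ⟨c, ⟨c, hc, sle_refl c⟩, hca.trans haa, hcb.trans hbb⟩
  · rintro ⟨a, ha, ha0⟩
    exact h0 (sle_zero ha0 ▸ ha)

/-- The source of a filter is the up-set generated by the elements `c⁻¹ * c`. -/
theorem src_eq_up {F : Set S} (hF : IsFilt F) : src F = up ((fun c => c⁻¹ * c) '' F) := by
  ext x
  constructor
  · rintro ⟨_, ⟨_, ⟨a, ha, rfl⟩, b, hb, rfl⟩, hx⟩
    obtain ⟨c, hc, hca, hcb⟩ := hF.2.2 a ha b hb
    exact ⟨_, ⟨c, hc, rfl⟩, (hca.inv.mul hcb).trans hx⟩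
  · rintro ⟨_, ⟨c, hc, rfl⟩, hx⟩
    exact ⟨_, ⟨c⁻¹, ⟨c, hc, rfl⟩, c, hc, rfl⟩, hx⟩

theorem IsPFilt.src {F : Set S} (hF : IsPFilt F) : IsPFilt (src F) := by
  rw [src_eq_up hF.1]
  refine isPFilt_up (hF.1.1.image _) ?_ ?_
  · rintro _ ⟨a, ha, rfl⟩ _ ⟨b, hb, rfl⟩
    obtain ⟨c, hc, hca, hcb⟩ := hF.1.2.2 a ha b hb
    exact ⟨_, ⟨c, hc, rfl⟩, hca.inv.mul hca, hcb.inv.mul hcb⟩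
  · rintro ⟨c, hc, h : c⁻¹ * c = 0⟩
    have hc0 : c = 0 := by rw [← mul_inv_mul c, mul_assoc, h, mul_zero]
    exact hF.2 (hc0 ▸ hc)

/-- Translating an idempotent `k ≤ s⁻¹ * s` by `s` yields an element with source `k`. -/
theorem inv_mul_translate {s k : S} (hk : sle k (s⁻¹ * s)) :
    (s * k)⁻¹ * (s * k) = k := by
  have hkk := hk.idem (inv_mul_idem s)
  have h := hk.eq_mul_idem (inv_mul_idem s)
  rw [mul_inv_rev', inv_of_idem hkk]
  calc k * s⁻¹ * (s * k) = k * (s⁻¹ * s) * k := by grind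
    _ = k := by rw [← h, hkk]

theorem isPFilt_translate {s : S} {H : Set S} (hH : IsPFilt H) (hs : s⁻¹ * s ∈ H) :
    IsPFilt (up ((s * ·) '' H)) := by
  refine isPFilt_up (hH.1.1.image _) ?_ ?_
  · rintro _ ⟨a, ha, rfl⟩ _ ⟨b, hb, rfl⟩
    obtain ⟨c, hc, hca, hcb⟩ := hH.1.2.2 a ha b hb
    exact ⟨_, ⟨c, hc, rfl⟩, (sle_refl s).mul hca, (sle_refl s).mul hcb⟩
  · rintro ⟨h, hh, h0 : s * h = 0⟩
    obtain ⟨k, hk, hks, hkh⟩ := hH.1.2.2 _ hs h hh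
    have hsk : s * k = 0 := sle_zero (h0 ▸ (sle_refl s).mul hkh)
    have hk0 : k = 0 := by rw [← inv_mul_translate hks, hsk, mul_zero]
    exact hH.2 (hk0 ▸ hk)

theorem src_translate {s : S} {H : Set S} (hH : IsPFilt H) (hs : s⁻¹ * s ∈ H) :
    src (up ((s * ·) '' H)) = H := by
  rw [src_eq_up (isPFilt_translate hH hs).1]
  ext x
  constructor
  · rintro ⟨_, ⟨c, ⟨_, ⟨h, hh, rfl⟩, hc⟩, rfl⟩, hx⟩
    obtain ⟨k, hk, hks, hkh⟩ := hH.1.2.2 _ hs h hh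
    have hkc : sle (s * k) c := ((sle_refl s).mul hkh).trans hc
    have := hkc.inv.mul hkc
    rw [inv_mul_translate hks] at this
    exact hH.1.mem_of_sle hk (this.trans hx)
  · intro hx
    obtain ⟨k, hk, hks, hkx⟩ := hH.1.2.2 _ hs x hx
    refine ⟨_, ⟨s * k, ⟨s * k, ⟨k, hk, rfl⟩, sle_refl _⟩, rfl⟩, ?_⟩
    simpa only [inv_mul_translate hks] using hkx

end InvSemigroupWithZero

/-- For every `s ∈ S`, `{d(F) : F proper filter, s ∈ F}` equals
`{H : H proper filter, s⁻¹·s ∈ H}`. -/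
theorem stmt_10 {S : Type*} [InvSemigroupWithZero S] (s : S) :
    {H : Set S | ∃ F : Set S, IsPFilt F ∧ s ∈ F ∧ H = src F}
      = {H : Set S | IsPFilt H ∧ s⁻¹ * s ∈ H} := by
  ext H
  constructor
  · rintro ⟨F, hF, hs, rfl⟩
    refine ⟨hF.src, ?_⟩
    rw [src_eq_up hF.1]
    exact ⟨_, ⟨s, hs, rfl⟩, sle_refl _⟩
  · rintro ⟨hH, hs⟩
    refine ⟨up ((s * ·) '' H), isPFilt_translate hH hs, ?_, (src_translate hH hs).symm⟩
    refine ⟨s, ⟨_, hs, ?_⟩, sle_refl s⟩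
    change s * (s⁻¹ * s) = s
    rw [← mul_assoc, mul_inv_mul]
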